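/- arXiv:2402.15188 — 2 statements merged into one kernel-verified Lean document; each statement's English description precedes it below -/
import Mathlib

section
/- Let h ≥ 1 be an integer, let P ⊆ Θ be a set (the parent cell, of depth h−1) with ‖x − y‖ ≤ √D · 2^{−(h−1)} for all x, y ∈ P, let C ⊆ P be nonempty (the child cell, of depth h), let θ_par ∈ P, and let θ_rep ∈ C satisfy DPR(θ_par, θ_rep) ≤ DPR(θ_par, θ) for all θ ∈ C (the representative chosen by minimizing the decoupled performative risk). Then PR(θ_rep) ≤ inf_{θ∈C} PR(θ) + 2·(2√D)^α · L_z · ε · 2^{−αh}. -/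
open MeasureTheory

/-- The performative risk `PR(θ) = E_{z ∼ 𝒟(θ)}[f(θ, z)]`. -/
noncomputable def PR {D : ℕ} {Z : Type*} [MeasurableSpace Z]
    (f : EuclideanSpace ℝ (Fin D) → Z → ℝ)
    (𝒟 : EuclideanSpace ℝ (Fin D) → Measure Z)
    (θ : EuclideanSpace ℝ (Fin D)) : ℝ :=
  ∫ z, f θ z ∂(𝒟 θ)

/-- The decoupled performative risk `DPR(θ, θ') = E_{z ∼ 𝒟(θ)}[f(θ', z)]`. -/
noncomputable def DPR {D : ℕ} {Z : Type*} [MeasurableSpace Z]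
    (f : EuclideanSpace ℝ (Fin D) → Z → ℝ)
    (𝒟 : EuclideanSpace ℝ (Fin D) → Measure Z)
    (θ θ' : EuclideanSpace ℝ (Fin D)) : ℝ :=
  ∫ z, f θ' z ∂(𝒟 θ)

/-- Kantorovich–Rubinstein bounds for `1`-Lipschitz test functions scale to `L`-Lipschitz ones. -/
theorem abs_integral_sub_integral_le_of_lipschitz {Z : Type*} [MeasurableSpace Z] [MetricSpace Z]
    {μ ν : Measure Z} {b L : ℝ} (hL : 0 < L)
    (hb : ∀ g : Z → ℝ, (∀ z z' : Z, |g z - g z'| ≤ dist z z') →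
      Integrable g μ → Integrable g ν → |(∫ z, g z ∂μ) - ∫ z, g z ∂ν| ≤ b)
    {g : Z → ℝ} (hg : ∀ z z' : Z, |g z - g z'| ≤ L * dist z z')
    (hμ : Integrable g μ) (hν : Integrable g ν) :
    |(∫ z, g z ∂μ) - ∫ z, g z ∂ν| ≤ L * b := by
  have key := hb (fun z => L⁻¹ * g z) (fun z z' => by
    rw [← mul_sub, abs_mul, abs_of_pos (inv_pos.2 hL), inv_mul_le_iff₀ hL]
    exact hg z z') (hμ.const_mul _) (hν.const_mul _)
  rwa [integral_const_mul, integral_const_mul, ← mul_sub, abs_mul, abs_of_pos (inv_pos.2 hL),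
    inv_mul_le_iff₀ hL] at key

/-- The `α`-th power of the diameter bound of a cell of depth `h - 1`, in terms of `h`. -/
theorem mul_two_rpow_neg_sub_one_rpow {s : ℝ} (hs : 0 ≤ s) (α h : ℝ) :
    (s * (2 : ℝ) ^ (-(h - 1))) ^ α = (2 * s) ^ α * (2 : ℝ) ^ (-(α * h)) := by
  have h_split : s * (2 : ℝ) ^ (-(h - 1)) = 2 * s * (2 : ℝ) ^ (-h) := by
    rw [show -(h - 1) = 1 + -h by ring, Real.rpow_add two_pos, Real.rpow_one]
    ring
  rw [h_split, Real.mul_rpow (by positivity) (by positivity), ← Real.rpow_mul zero_le_two,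
    show -h * α = -(α * h) by ring]

/-- If the parent cell `P` (depth `h−1`) has diameter at most `√D·2^{−(h−1)}`, the child cell
`C ⊆ P` is nonempty, and `θ_rep ∈ C` minimizes `DPR(θ_par, ·)` over `C`, then
`PR(θ_rep) ≤ inf_{θ∈C} PR(θ) + 2·(2√D)^α · L_z · ε · 2^{−αh}`. -/
theorem stmt4 {D : ℕ} (hD : 1 ≤ D)
    {Z : Type*} [MeasurableSpace Z] [MetricSpace Z]
    (Θ : Set (EuclideanSpace ℝ (Fin D))) (hΘ : Θ.Nonempty)
    (f : EuclideanSpace ℝ (Fin D) → Z → ℝ)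
    (𝒟 : EuclideanSpace ℝ (Fin D) → Measure Z)
    (hprob : ∀ θ, IsProbabilityMeasure (𝒟 θ))
    (hint : ∀ θ ∈ Θ, ∀ θ' ∈ Θ, Integrable (f θ') (𝒟 θ))
    {ε α Lz : ℝ} (hε : 0 < ε) (hα : 0 < α) (hLz : 0 < Lz)
    (hsens : ∀ θ ∈ Θ, ∀ θ' ∈ Θ, ∀ g : Z → ℝ,
      (∀ z z' : Z, |g z - g z'| ≤ dist z z') →
      Integrable g (𝒟 θ) → Integrable g (𝒟 θ') →
      |(∫ z, g z ∂(𝒟 θ)) - ∫ z, g z ∂(𝒟 θ')| ≤ ε * ‖θ - θ'‖ ^ α)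
    (hlip : ∀ θ ∈ Θ, ∀ z z' : Z, |f θ z - f θ z'| ≤ Lz * dist z z')
    (h : ℕ) (hh : 1 ≤ h)
    (P : Set (EuclideanSpace ℝ (Fin D))) (hPΘ : P ⊆ Θ)
    (hdiam : ∀ x ∈ P, ∀ y ∈ P, ‖x - y‖ ≤ Real.sqrt D * (2 : ℝ) ^ (-((h : ℝ) - 1)))
    (C : Set (EuclideanSpace ℝ (Fin D))) (hCP : C ⊆ P) (hC : C.Nonempty)
    (θpar : EuclideanSpace ℝ (Fin D)) (hθpar : θpar ∈ P)
    (θrep : EuclideanSpace ℝ (Fin D)) (hθrep : θrep ∈ C)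
    (hmin : ∀ θ ∈ C, DPR f 𝒟 θpar θrep ≤ DPR f 𝒟 θpar θ)
    (hatt : ∃ θ ∈ C, ∀ θ' ∈ C, PR f 𝒟 θ ≤ PR f 𝒟 θ') :
    PR f 𝒟 θrep ≤
      sInf (PR f 𝒟 '' C) + 2 * (2 * Real.sqrt D) ^ α * Lz * ε * (2 : ℝ) ^ (-(α * h)) := by
  set B : ℝ := (2 * Real.sqrt D) ^ α * (2 : ℝ) ^ (-(α * h)) with hB
  have h_shift : ∀ θ ∈ P, |DPR f 𝒟 θ θ - DPR f 𝒟 θpar θ| ≤ Lz * (ε * B) := by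
    intro θ hθ
    have hpow : ‖θ - θpar‖ ^ α ≤ B := by
      rw [hB, ← mul_two_rpow_neg_sub_one_rpow (Real.sqrt_nonneg _)]
      exact Real.rpow_le_rpow (norm_nonneg _) (hdiam θ hθ θpar hθpar) hα.le
    refine abs_integral_sub_integral_le_of_lipschitz hLz (fun g hg hμ hν => ?_)
      (hlip θ (hPΘ hθ)) (hint θ (hPΘ hθ) θ (hPΘ hθ)) (hint θpar (hPΘ hθpar) θ (hPΘ hθ))
    exact (hsens θ (hPΘ hθ) θpar (hPΘ hθpar) g hg hμ hν).trans
      (mul_le_mul_of_nonneg_left hpow hε.le)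
  have h_inf : PR f 𝒟 θrep - 2 * (Lz * (ε * B)) ≤ sInf (PR f 𝒟 '' C) := by
    refine le_csInf (hC.image _) ?_
    rintro _ ⟨θ, hθ, rfl⟩
    have h_rep := (abs_le.1 (h_shift θrep (hCP hθrep))).2
    have h_opt := (abs_le.1 (h_shift θ (hCP hθ))).1
    have h_le := hmin θ hθ
    change DPR f 𝒟 θrep θrep - _ ≤ DPR f 𝒟 θ θ
    linarith
  calc PR f 𝒟 θrep ≤ sInf (PR f 𝒟 '' C) + 2 * (Lz * (ε * B)) := by linarith
    _ = _ := by rw [hB]; ring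
end

section
/- Let h ≥ 1 be an integer, let P ⊆ Θ with ‖x − y‖ ≤ √D · 2^{−(h−1)} for all x, y ∈ P, let C ⊆ P be nonempty, and let θ_par ∈ P. Let β ≥ 0 and let g : C → ℝ (an empirical estimate of the decoupled performative risk) satisfy |g(θ) − DPR(θ_par, θ)| ≤ β for all θ ∈ C. If θ_rep ∈ C satisfies g(θ_rep) ≤ g(θ) for all θ ∈ C, then PR(θ_rep) ≤ inf_{θ∈C} PR(θ) + 2·(2√D)^α · L_z · ε · 2^{−αh} + 2β. -/
open MeasureTheory

/-- Sensitivity rescaled to `L`-Lipschitz test functions. -/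
theorem abs_integral_sub_le_of_lipschitz {Z : Type*} [MeasurableSpace Z] [MetricSpace Z]
    {μ ν : Measure Z} {L c : ℝ} (hL : 0 < L)
    (hμν : ∀ g : Z → ℝ, (∀ z z' : Z, |g z - g z'| ≤ dist z z') →
      Integrable g μ → Integrable g ν → |(∫ z, g z ∂μ) - ∫ z, g z ∂ν| ≤ c)
    {φ : Z → ℝ} (hφ : ∀ z z' : Z, |φ z - φ z'| ≤ L * dist z z')
    (hφμ : Integrable φ μ) (hφν : Integrable φ ν) :
    |(∫ z, φ z ∂μ) - ∫ z, φ z ∂ν| ≤ L * c := by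
  have key := hμν (fun z => L⁻¹ * φ z)
    (fun z z' => by
      rw [← mul_sub, abs_mul, abs_of_pos (inv_pos.2 hL), inv_mul_le_iff₀ hL]
      exact hφ z z')
    (hφμ.const_mul _) (hφν.const_mul _)
  rwa [integral_const_mul, integral_const_mul, ← mul_sub, abs_mul,
    abs_of_pos (inv_pos.2 hL), inv_mul_le_iff₀ hL] at key

/-- The diameter of a depth-`h` cell raised to the power `α`. -/
theorem sqrt_mul_two_rpow_rpow (d h α : ℝ) :
    (Real.sqrt d * (2 : ℝ) ^ (-(h - 1))) ^ α =
      (2 * Real.sqrt d) ^ α * (2 : ℝ) ^ (-(α * h)) := by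
  have hs : Real.sqrt d * (2 : ℝ) ^ (-(h - 1)) = 2 * Real.sqrt d * (2 : ℝ) ^ (-h) := by
    rw [neg_sub, sub_eq_add_neg, Real.rpow_add two_pos, Real.rpow_one]
    ring
  rw [hs, Real.mul_rpow (by positivity) (by positivity), ← Real.rpow_mul two_pos.le]
  congr 2
  ring

/-- Data-driven cell approximation: if `g` estimates `DPR(θ_par, ·)` on `C` up to error `β` and
`θ_rep` minimizes `g` over `C`, then
`PR(θ_rep) ≤ inf_{θ∈C} PR(θ) + 2·(2√D)^α · L_z · ε · 2^{−αh} + 2β`. -/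
theorem stmt6 {D : ℕ} (hD : 1 ≤ D)
    {Z : Type*} [MeasurableSpace Z] [MetricSpace Z]
    (Θ : Set (EuclideanSpace ℝ (Fin D))) (hΘ : Θ.Nonempty)
    (f : EuclideanSpace ℝ (Fin D) → Z → ℝ)
    (𝒟 : EuclideanSpace ℝ (Fin D) → Measure Z)
    (hprob : ∀ θ, IsProbabilityMeasure (𝒟 θ))
    (hint : ∀ θ ∈ Θ, ∀ θ' ∈ Θ, Integrable (f θ') (𝒟 θ))
    {ε α Lz : ℝ} (hε : 0 < ε) (hα : 0 < α) (hLz : 0 < Lz)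
    (hsens : ∀ θ ∈ Θ, ∀ θ' ∈ Θ, ∀ g : Z → ℝ,
      (∀ z z' : Z, |g z - g z'| ≤ dist z z') →
      Integrable g (𝒟 θ) → Integrable g (𝒟 θ') →
      |(∫ z, g z ∂(𝒟 θ)) - ∫ z, g z ∂(𝒟 θ')| ≤ ε * ‖θ - θ'‖ ^ α)
    (hlip : ∀ θ ∈ Θ, ∀ z z' : Z, |f θ z - f θ z'| ≤ Lz * dist z z')
    (h : ℕ) (hh : 1 ≤ h)
    (P : Set (EuclideanSpace ℝ (Fin D))) (hPΘ : P ⊆ Θ)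
    (hdiam : ∀ x ∈ P, ∀ y ∈ P, ‖x - y‖ ≤ Real.sqrt D * (2 : ℝ) ^ (-((h : ℝ) - 1)))
    (C : Set (EuclideanSpace ℝ (Fin D))) (hCP : C ⊆ P) (hC : C.Nonempty)
    (θpar : EuclideanSpace ℝ (Fin D)) (hθpar : θpar ∈ P)
    {β : ℝ} (hβ : 0 ≤ β)
    (g : EuclideanSpace ℝ (Fin D) → ℝ)
    (hg : ∀ θ ∈ C, |g θ - DPR f 𝒟 θpar θ| ≤ β)
    (θrep : EuclideanSpace ℝ (Fin D)) (hθrep : θrep ∈ C)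
    (hmin : ∀ θ ∈ C, g θrep ≤ g θ)
    (hatt : ∃ θ ∈ C, ∀ θ' ∈ C, PR f 𝒟 θ ≤ PR f 𝒟 θ') :
    PR f 𝒟 θrep ≤
      sInf (PR f 𝒟 '' C) + 2 * (2 * Real.sqrt D) ^ α * Lz * ε * (2 : ℝ) ^ (-(α * h))
        + 2 * β := by
  have hdiff : ∀ θ ∈ C, |PR f 𝒟 θ - DPR f 𝒟 θpar θ| ≤
      Lz * (ε * ((2 * Real.sqrt D) ^ α * (2 : ℝ) ^ (-(α * h)))) := by
    intro θ hθ
    have hθP := hCP hθ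
    refine (abs_integral_sub_le_of_lipschitz hLz (hsens θ (hPΘ hθP) θpar (hPΘ hθpar))
      (hlip θ (hPΘ hθP)) (hint _ (hPΘ hθP) _ (hPΘ hθP))
      (hint _ (hPΘ hθpar) _ (hPΘ hθP))).trans ?_
    rw [← sqrt_mul_two_rpow_rpow]
    gcongr
    exact hdiam θ hθP θpar hθpar
  have hinf : PR f 𝒟 θrep - 2 * (2 * Real.sqrt D) ^ α * Lz * ε * (2 : ℝ) ^ (-(α * h))
      - 2 * β ≤ sInf (PR f 𝒟 '' C) := by
    refine le_csInf (hC.image _) ?_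
    rintro _ ⟨θ, hθ, rfl⟩
    have h₁ := (abs_le.1 (hdiff θrep hθrep)).2
    have h₂ := (abs_le.1 (hdiff θ hθ)).1
    have h₃ := (abs_le.1 (hg θrep hθrep)).1
    have h₄ := (abs_le.1 (hg θ hθ)).2
    have h₅ := hmin θ hθ
    linarith
  linarith
end
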